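/- arXiv:math/0403076 — 2 statements merged into one kernel-verified Lean document; each statement's English description precedes it below -/
import Mathlib

section
/- Let π be a ∗-representation of X on a complex Hilbert space H. Set H_∞ = ker π(y₀), K₀ = ker(π(y₀) − α^{-1}·I), and let H₁ be the closed linear span of ⋃_{𝔫 ∈ ℕ^d} π((x^𝔫)*)K₀ (the term 𝔫 = 0 being K₀ itself). Then: H₁ and H_∞ are invariant under π(T) for every T ∈ X; H₁ is orthogonal to H_∞; and H is the orthogonal direct sum H₁ ⊕ H_∞ (equivalently, any vector orthogonal to both H₁ and H_∞ is zero). -/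
noncomputable section

/-- The Hilbert space `ℓ²(ℕ^d)`. -/
abbrev L2 (d : ℕ) := lp (fun _ : Fin d → ℕ => ℂ) 2

/-- Bounded operators on `ℓ²(ℕ^d)`. -/
abbrev BdOp (d : ℕ) := L2 d →L[ℂ] L2 d

/-- The standard basis vector `e_𝔫` of `ℓ²(ℕ^d)`. -/
def e2 (d : ℕ) (n : Fin d → ℕ) : L2 d := lp.single 2 n (1 : ℂ)

/-- The total degree `|𝔫| = n₁ + ⋯ + n_d`. -/
def degIdx (d : ℕ) (n : Fin d → ℕ) : ℕ := ∑ k, n k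

/-- The multi-index resulting from applying `a_k` (`k > 0`: annihilation at
slot `k`, `k < 0`: creation at slot `−k`, `k = 0` or `|k| > d`: identity)
to the basis vector `e_𝔫`. -/
def aIdx (d : ℕ) (k : ℤ) (n : Fin d → ℕ) : Fin d → ℕ :=
  if h : 0 < k ∧ k ≤ (d : ℤ) then
    Function.update n ⟨(k - 1).toNat, by omega⟩ (n ⟨(k - 1).toNat, by omega⟩ - 1)
  else if h' : 0 < -k ∧ -k ≤ (d : ℤ) then
    Function.update n ⟨(-k - 1).toNat, by omega⟩ (n ⟨(-k - 1).toNat, by omega⟩ + 1)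
  else n

/-- The coefficient of `a_k e_𝔫`: `√(n_k)` for `k > 0`, `√(n_{−k}+1)` for
`k < 0`, and `1` for `k = 0`, so that `a_k e_𝔫 = (aCoef k 𝔫) • e_{aIdx k 𝔫}`. -/
def aCoef (d : ℕ) (k : ℤ) (n : Fin d → ℕ) : ℝ :=
  if h : 0 < k ∧ k ≤ (d : ℤ) then Real.sqrt (n ⟨(k - 1).toNat, by omega⟩)
  else if h' : 0 < -k ∧ -k ≤ (d : ℤ) then Real.sqrt (n ⟨(-k - 1).toNat, by omega⟩ + 1)
  else 1

/-- The multi-index of `x_{kl} e_𝔫`. -/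
def xIdx (d : ℕ) (k l : ℤ) (n : Fin d → ℕ) : Fin d → ℕ := aIdx d k (aIdx d l n)

/-- The coefficient of `x_{kl} e_𝔫`, where `x_{kl} = a_k a_l (N+α)⁻¹` if
`k ≥ 0` or `l ≥ 0`, and `x_{kl} = (N+α)⁻¹ a_k a_l` if `k < 0` and `l < 0`. -/
def xCoef (d : ℕ) (α : ℝ) (k l : ℤ) (n : Fin d → ℕ) : ℝ :=
  if 0 ≤ k ∨ 0 ≤ l then aCoef d k (aIdx d l n) * aCoef d l n / (degIdx d n + α)
  else aCoef d k (aIdx d l n) * aCoef d l n / (degIdx d (xIdx d k l n) + α)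

/-- The eigenvalue of `y_m = (N + α + m)⁻¹` on `e_𝔫`. -/
def yCoef (d : ℕ) (α : ℝ) (m : ℤ) (n : Fin d → ℕ) : ℝ :=
  ((degIdx d n : ℝ) + α + m)⁻¹

/-- `xop`, `yop` implement the operators `x_{kl}` and `y_n` of Section 3:
each `x_{kl}` (for `|k|, |l| ≤ d`) acts on basis vectors as the continuous
extension of `a_k a_l (N+α)⁻¹` resp. `(N+α)⁻¹ a_k a_l`, and each `y_m` acts
diagonally with eigenvalue `(|𝔫|+α+m)⁻¹`. -/
def IsXYSystem (d : ℕ) (α : ℝ) (xop : ℤ → ℤ → BdOp d) (yop : ℤ → BdOp d) : Prop :=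
  (∀ k l : ℤ, |k| ≤ (d : ℤ) → |l| ≤ (d : ℤ) → ∀ n : Fin d → ℕ,
    xop k l (e2 d n) = (xCoef d α k l n : ℂ) • e2 d (xIdx d k l n)) ∧
  (∀ m : ℤ, ∀ n : Fin d → ℕ, yop m (e2 d n) = (yCoef d α m n : ℂ) • e2 d n)

/-- The auxiliary ∗-algebra `X`: the unital subalgebra of `B(ℓ²(ℕ^d))`
generated by the `x_{kl}` (`k, l = −d, …, d`) and the `y_n` (`n ∈ ℕ₀`). -/
def Xalg (d : ℕ) (xop : ℤ → ℤ → BdOp d) (yop : ℤ → BdOp d) :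
    Subalgebra ℂ (BdOp d) :=
  Algebra.adjoin ℂ
    ({T | ∃ k l : ℤ, |k| ≤ (d : ℤ) ∧ |l| ≤ (d : ℤ) ∧ T = xop k l} ∪
      {T | ∃ m : ℕ, T = yop m})

/-- `Σ²(X)`: finite sums `Σ_i g_i* g_i` with `g_i ∈ X`. -/
def XSumSq (d : ℕ) (X : Subalgebra ℂ (BdOp d)) : Set (BdOp d) :=
  {T | ∃ (m : ℕ) (g : Fin m → BdOp d),
    (∀ i, g i ∈ X) ∧ T = ∑ i, star (g i) * g i}

/-- The operator `x^𝔫 = x₁^{n₁} ⋯ x_d^{n_d}`, where `x_k = x_{k0}`. -/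
def xPowZ (d : ℕ) (xop : ℤ → ℤ → BdOp d) (n : Fin d → ℕ) : BdOp d :=
  (List.ofFn fun k : Fin d => xop ((k : ℕ) + 1 : ℤ) 0 ^ n k).prod

/-- A ∗-representation of `X` on `H`: a unital ℂ-algebra homomorphism into the
bounded operators on `H` respecting adjoints (`π(T*) = π(T)*`). -/
def IsStarRep (d : ℕ) (xop : ℤ → ℤ → BdOp d) (yop : ℤ → BdOp d)
    {H : Type*} [NormedAddCommGroup H] [InnerProductSpace ℂ H] [CompleteSpace H]
    (π : ↥(Xalg d xop yop) →ₐ[ℂ] (H →L[ℂ] H)) : Prop :=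
  ∀ T U : ↥(Xalg d xop yop), (T : BdOp d) = star (U : BdOp d) → π T = star (π U)

open scoped InnerProductSpace

section ConcreteOperators

variable {d : ℕ}

theorem inner_e2_left (m : Fin d → ℕ) (f : L2 d) : ⟪e2 d m, f⟫_ℂ = f m := by
  rw [e2, lp.inner_single_left]
  simp

theorem e2_apply (n m : Fin d → ℕ) : (e2 d n : (Fin d → ℕ) → ℂ) m = if m = n then 1 else 0 := by
  rw [e2, lp.coeFn_single, Pi.single_apply]

theorem inner_e2_e2 (m n : Fin d → ℕ) : ⟪e2 d m, e2 d n⟫_ℂ = if m = n then 1 else 0 := by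
  rw [inner_e2_left, e2_apply]

/-- A bounded operator on `ℓ²(ℕ^d)` is determined by its values on the standard basis. -/
theorem bdOp_ext {S T : BdOp d} (h : ∀ n, S (e2 d n) = T (e2 d n)) : S = T := by
  ext1 f
  have hf := lp.hasSum_single (p := 2) (by simp) f
  have hsingle : ∀ n : Fin d → ℕ, lp.single 2 n (f n) = f n • e2 d n := by
    intro n
    rw [e2, ← lp.single_smul]
    simp
  refine (hf.mapL S).unique ?_
  convert hf.mapL T using 2 with n
  rw [hsingle, map_smul, map_smul, h]

theorem bdOp_ext_inner {S T : BdOp d}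
    (h : ∀ m n, ⟪e2 d m, S (e2 d n)⟫_ℂ = ⟪e2 d m, T (e2 d n)⟫_ℂ) : S = T := by
  refine bdOp_ext fun n => ?_
  ext m
  simpa only [inner_e2_left] using h m n

theorem degIdx_update_add (n : Fin d → ℕ) (j : Fin d) (b : ℕ) :
    degIdx d (Function.update n j b) + n j = degIdx d n + b := by
  unfold degIdx
  rw [Finset.sum_update_of_mem (Finset.mem_univ j),
    ← Finset.add_sum_erase _ n (Finset.mem_univ j), Finset.sdiff_singleton_eq_erase]
  ring

/-- `a_k` lowers the total degree by `sign k`. -/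
theorem degIdx_aIdx {k : ℤ} (hk : |k| ≤ d) {n : Fin d → ℕ} (h : aCoef d k n ≠ 0) :
    (degIdx d (aIdx d k n) : ℤ) = degIdx d n - k.sign := by
  rw [abs_le] at hk
  rcases lt_trichotomy k 0 with hk0 | rfl | hk0
  · have h' : 0 < -k ∧ -k ≤ (d : ℤ) := by omega
    rw [aIdx, dif_neg (by omega), dif_pos h', Int.sign_eq_neg_one_of_neg hk0]
    have := degIdx_update_add n ⟨(-k - 1).toNat, by omega⟩ (n ⟨(-k - 1).toNat, by omega⟩ + 1)
    omega
  · simp [aIdx]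
  · have h' : 0 < k ∧ k ≤ (d : ℤ) := by omega
    rw [aCoef, dif_pos h'] at h
    have hn : n ⟨(k - 1).toNat, by omega⟩ ≠ 0 := by
      intro h0
      exact h (by rw [h0]; simp)
    rw [aIdx, dif_pos h', Int.sign_eq_one_of_pos hk0]
    have := degIdx_update_add n ⟨(k - 1).toNat, by omega⟩ (n ⟨(k - 1).toNat, by omega⟩ - 1)
    omega

theorem aIdx_pos (j : Fin d) (n : Fin d → ℕ) :
    aIdx d ((j : ℕ) + 1 : ℤ) n = Function.update n j (n j - 1) := by
  have h : 0 < ((j : ℕ) + 1 : ℤ) ∧ ((j : ℕ) + 1 : ℤ) ≤ d := by omega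
  have hj : (⟨(((j : ℕ) + 1 : ℤ) - 1).toNat, by omega⟩ : Fin d) = j := by ext; simp
  rw [aIdx, dif_pos h, hj]

theorem aCoef_pos (j : Fin d) (n : Fin d → ℕ) :
    aCoef d ((j : ℕ) + 1 : ℤ) n = Real.sqrt (n j) := by
  have h : 0 < ((j : ℕ) + 1 : ℤ) ∧ ((j : ℕ) + 1 : ℤ) ≤ d := by omega
  have hj : (⟨(((j : ℕ) + 1 : ℤ) - 1).toNat, by omega⟩ : Fin d) = j := by ext; simp
  rw [aCoef, dif_pos h, hj]

variable {α : ℝ} {xop : ℤ → ℤ → BdOp d} {yop : ℤ → BdOp d}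

/-- The action of the annihilation-type generator `x_j = x_{j0}` on the standard basis. -/
theorem IsXYSystem.xop_pos_zero (hxy : IsXYSystem d α xop yop) (j : Fin d) (n : Fin d → ℕ) :
    xop ((j : ℕ) + 1 : ℤ) 0 (e2 d n) =
      ((Real.sqrt (n j) / (degIdx d n + α) : ℝ) : ℂ) •
        e2 d (Function.update n j (n j - 1)) := by
  rw [hxy.1 _ _ (abs_le.2 (by omega)) (by simp)]
  have h0 : aIdx d 0 n = n := by simp [aIdx]
  have h0' : aCoef d 0 n = 1 := by simp [aCoef]
  rw [xCoef, xIdx, h0, h0', aIdx_pos, aCoef_pos, if_pos (Or.inr le_rfl), mul_one]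

theorem IsXYSystem.yop_apply (hxy : IsXYSystem d α xop yop) (m : ℤ) (n : Fin d → ℕ) :
    yop m (e2 d n) = (((degIdx d n + α + m)⁻¹ : ℝ) : ℂ) • e2 d n := hxy.2 m n

theorem IsXYSystem.star_yop (hxy : IsXYSystem d α xop yop) (m : ℤ) :
    star (yop m) = yop m := by
  refine bdOp_ext_inner fun k n => ?_
  rw [ContinuousLinearMap.star_eq_adjoint, ContinuousLinearMap.adjoint_inner_right,
    hxy.yop_apply, hxy.yop_apply, inner_smul_left, inner_smul_right, inner_e2_e2]
  split_ifs with h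
  · subst h; simp
  · simp

theorem IsXYSystem.commute_xop (hxy : IsXYSystem d α xop yop) (i j : Fin d) :
    xop ((i : ℕ) + 1 : ℤ) 0 * xop ((j : ℕ) + 1 : ℤ) 0 =
      xop ((j : ℕ) + 1 : ℤ) 0 * xop ((i : ℕ) + 1 : ℤ) 0 := by
  rcases eq_or_ne i j with rfl | hij
  · rfl
  refine bdOp_ext fun n => ?_
  simp only [mul_apply_eq_comp, hxy.xop_pos_zero, map_smul, Function.update_of_ne hij,
    Function.update_of_ne hij.symm, smul_smul, ← Complex.ofReal_mul]
  rw [Function.update_comm hij]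
  congr 2
  have hi := degIdx_update_add n i (n i - 1)
  have hj := degIdx_update_add n j (n j - 1)
  rcases Nat.eq_zero_or_pos (n i) with h0 | h0
  · simp [h0]
  rcases Nat.eq_zero_or_pos (n j) with h1 | h1
  · simp [h1]
  have : degIdx d (Function.update n i (n i - 1)) = degIdx d (Function.update n j (n j - 1)) := by
    omega
  rw [this]
  ring

/-- `Σ_j x_j* x_j = N (N + α)⁻² = y₀ - α y₀²`. -/
theorem IsXYSystem.sum_star_xop_mul_xop (hxy : IsXYSystem d α xop yop) (hα : 0 < α) :
    ∑ j : Fin d, star (xop ((j : ℕ) + 1 : ℤ) 0) * xop ((j : ℕ) + 1 : ℤ) 0 =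
      yop 0 - (α : ℂ) • (yop 0 * yop 0) := by
  refine bdOp_ext_inner fun m n => ?_
  simp only [sum_apply, mul_apply_eq_comp, inner_sum,
    ContinuousLinearMap.star_eq_adjoint, ContinuousLinearMap.adjoint_inner_right,
    hxy.xop_pos_zero, sub_apply, smul_apply, hxy.yop_apply, map_smul, inner_sub_right,
    inner_smul_left, inner_smul_right, inner_e2_e2, Complex.conj_ofReal]
  by_cases hmn : m = n
  · subst hmn
    have hpos : (0 : ℝ) < degIdx d m + α := by positivity
    have hsum : ∑ j : Fin d, (Real.sqrt (m j) / (degIdx d m + α)) ^ 2 =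
        degIdx d m / (degIdx d m + α) ^ 2 := by
      simp only [div_pow, Real.sq_sqrt (Nat.cast_nonneg _)]
      rw [← Finset.sum_div]
      simp [degIdx]
    have hreal : (degIdx d m : ℝ) / (degIdx d m + α) ^ 2 =
        (degIdx d m + α)⁻¹ - α * ((degIdx d m + α)⁻¹ * (degIdx d m + α)⁻¹) := by
      field_simp
      ring
    simp only [if_true, mul_one, Int.cast_zero, add_zero]
    rw [hreal] at hsum
    have := congrArg (fun r : ℝ => (r : ℂ)) hsum
    push_cast at this ⊢
    rw [← this]
    exact Finset.sum_congr rfl fun _ _ => by ring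
  · simp only [if_neg hmn, mul_zero, sub_zero]
    refine Finset.sum_eq_zero fun j _ => ?_
    rcases Nat.eq_zero_or_pos (n j) with h0 | h0
    · simp [h0]
    rcases Nat.eq_zero_or_pos (m j) with h1 | h1
    · simp [h1]
    rw [if_neg, mul_zero, mul_zero]
    intro h
    refine hmn (funext fun i => ?_)
    have hi := congrFun h i
    rcases eq_or_ne i j with rfl | hij
    · simp only [Function.update_self] at hi
      omega
    · simpa [Function.update_of_ne hij] using hi

/-- The generators `x_{kl}` are homogeneous: `N x_{kl} = x_{kl} (N - sign k - sign l)`, written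
with the resolvent `y₀ = (N + α)⁻¹`. -/
theorem IsXYSystem.yop_mul_xop (hxy : IsXYSystem d α xop yop) (hα : 0 < α) {k l : ℤ}
    (hk : |k| ≤ d) (hl : |l| ≤ d) :
    yop 0 * xop k l = xop k l * yop 0 +
      ((k.sign + l.sign : ℤ) : ℂ) • (yop 0 * xop k l * yop 0) := by
  refine bdOp_ext fun n => ?_
  simp only [mul_apply_eq_comp, add_apply, smul_apply, hxy.yop_apply, map_smul, hxy.1 k l hk hl,
    smul_smul, ← add_smul]
  by_cases h : aCoef d k (aIdx d l n) = 0 ∨ aCoef d l n = 0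
  · have : xCoef d α k l n = 0 := by
      rcases h with h | h <;> simp [xCoef, h]
    simp [this]
  · push Not at h
    have hdeg : (degIdx d (xIdx d k l n) : ℤ) = degIdx d n - k.sign - l.sign := by
      rw [xIdx, degIdx_aIdx hk h.1, degIdx_aIdx hl h.2]
      ring
    have hs : ((k.sign + l.sign : ℤ) : ℝ) = degIdx d n - degIdx d (xIdx d k l n) := by
      have : k.sign + l.sign = (degIdx d n : ℤ) - degIdx d (xIdx d k l n) := by
        rw [hdeg]; ring
      rw [this]
      push_cast
      ring
    have h1 : (degIdx d n : ℝ) + α ≠ 0 := by positivity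
    have h2 : (degIdx d (xIdx d k l n) : ℝ) + α ≠ 0 := by positivity
    congr 1
    rw [← Complex.ofReal_intCast, hs]
    simp only [← Complex.ofReal_mul, ← Complex.ofReal_add, Int.cast_zero, add_zero]
    congr 1
    field_simp
    ring

theorem IsXYSystem.commute_yop (hxy : IsXYSystem d α xop yop) (m : ℤ) :
    yop 0 * yop m = yop m * yop 0 := by
  refine bdOp_ext fun n => ?_
  simp only [mul_apply_eq_comp, hxy.yop_apply, map_smul]
  rw [smul_comm]

open scoped IsMulCommutative in
theorem IsXYSystem.xPowZ_add_single (hxy : IsXYSystem d α xop yop) (n : Fin d → ℕ) (j : Fin d) :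
    xPowZ d xop (n + Pi.single j 1) = xPowZ d xop n * xop ((j : ℕ) + 1 : ℤ) 0 := by
  let s : Set (BdOp d) := Set.range fun j : Fin d => xop ((j : ℕ) + 1 : ℤ) 0
  have hs : ∀ a ∈ s, ∀ b ∈ s, a * b = b * a := by
    rintro _ ⟨i, rfl⟩ _ ⟨j, rfl⟩
    exact hxy.commute_xop i j
  have := Algebra.isMulCommutative_adjoin ℂ hs
  let g : Fin d → Algebra.adjoin ℂ s := fun j =>
    ⟨xop ((j : ℕ) + 1 : ℤ) 0, Algebra.subset_adjoin ⟨j, rfl⟩⟩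
  have hval : ∀ m : Fin d → ℕ, xPowZ d xop m = ((∏ k, g k ^ m k : Algebra.adjoin ℂ s) : BdOp d) := by
    intro m
    rw [← List.prod_ofFn, ← Subalgebra.coe_val, map_list_prod, List.map_ofFn]
    rfl
  have hprod : ∏ k, g k ^ (n + Pi.single j 1 : Fin d → ℕ) k = (∏ k, g k ^ n k) * g j := by
    simp only [Pi.add_apply, pow_add, Finset.prod_mul_distrib]
    congr 1
    rw [Finset.prod_eq_single j] <;> simp +contextual
  rw [hval, hprod, hval]
  rfl

theorem xPowZ_zero : xPowZ d xop 0 = 1 := by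
  simp [xPowZ]

end ConcreteOperators

section LoweringSystem

variable {H : Type*} [NormedAddCommGroup H] [InnerProductSpace ℂ H]
  {ι : Type*} [Fintype ι] {α : ℝ} {Y : H →L[ℂ] H} {X : ι → H →L[ℂ] H}

/-- Operators `Y` and `X_j` obeying the relations of `(N + α)⁻¹` and `a_j (N + α)⁻¹`. -/
structure IsLoweringSystem (α : ℝ) (Y : H →L[ℂ] H) (X : ι → H →L[ℂ] H) : Prop where
  inner_symm : ∀ u v, ⟪Y u, v⟫_ℂ = ⟪u, Y v⟫_ℂ
  sum_inner : ∀ u v, ∑ j, ⟪X j u, X j v⟫_ℂ = ⟪u, Y v⟫_ℂ - (α : ℂ) * ⟪Y u, Y v⟫_ℂ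
  map_apply : ∀ j v, Y (X j v) = X j (Y v) + Y (X j (Y v))

namespace IsLoweringSystem

theorem re_inner_comm (u v : H) : (⟪u, v⟫_ℂ).re = (⟪v, u⟫_ℂ).re :=
  inner_re_symm (𝕜 := ℂ) u v

theorem re_inner_self (u : H) : (⟪u, u⟫_ℂ).re = ‖u‖ ^ 2 :=
  inner_self_eq_norm_sq (𝕜 := ℂ) u

theorem sum_norm_sq (h : IsLoweringSystem α Y X) (v : H) :
    ∑ j, ‖X j v‖ ^ 2 = (⟪v, Y v⟫_ℂ).re - α * ‖Y v‖ ^ 2 := by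
  have := congrArg Complex.re (h.sum_inner v v)
  rwa [Complex.re_sum, Complex.sub_re, Complex.re_ofReal_mul, re_inner_self,
    Finset.sum_congr rfl fun j _ => re_inner_self (X j v)] at this

theorem mul_norm_sq_le (h : IsLoweringSystem α Y X) (v : H) :
    α * ‖Y v‖ ^ 2 ≤ (⟪v, Y v⟫_ℂ).re := by
  have := h.sum_norm_sq v
  have : 0 ≤ ∑ j, ‖X j v‖ ^ 2 := by positivity
  linarith

theorem re_inner_nonneg (h : IsLoweringSystem α Y X) (hα : 0 < α) (v : H) :
    0 ≤ (⟪v, Y v⟫_ℂ).re :=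
  le_trans (by positivity) (h.mul_norm_sq_le v)

theorem mul_re_inner_le (h : IsLoweringSystem α Y X) (hα : 0 < α) (v : H) :
    α * (⟪v, Y v⟫_ℂ).re ≤ ‖v‖ ^ 2 := by
  have h1 := h.mul_norm_sq_le v
  have h2 : (⟪v, Y v⟫_ℂ).re ≤ ‖v‖ * ‖Y v‖ := re_inner_le_norm (𝕜 := ℂ) v (Y v)
  have h3 : α * ‖Y v‖ ≤ ‖v‖ := by
    rcases (norm_nonneg (Y v)).eq_or_lt with h0 | h0
    · rw [← h0]; simp
    · nlinarith
  nlinarith [norm_nonneg v]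

/-- Positivity of `Y (1 - α Y) (1 - (α + 1) Y) Y`, which reflects `N (N - 1) ≥ 0`. -/
theorem quadratic_nonneg (h : IsLoweringSystem α Y X) (v : H) :
    0 ≤ ‖Y v‖ ^ 2 - (1 + 2 * α) * (⟪Y v, Y (Y v)⟫_ℂ).re + α * (1 + α) * ‖Y (Y v)‖ ^ 2 := by
  have hj : ∀ j, Y (X j (v - Y v)) = X j (Y v) := fun j => by
    rw [map_sub, map_sub, h.map_apply, add_sub_cancel_right]
  have hnn : 0 ≤ ∑ j, ((⟪X j (v - Y v), X j (Y v)⟫_ℂ).re - α * ‖X j (Y v)‖ ^ 2) :=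
    Finset.sum_nonneg fun j _ => by
      have := h.mul_norm_sq_le (X j (v - Y v))
      rw [hj] at this
      linarith
  rw [Finset.sum_sub_distrib, ← Finset.mul_sum, h.sum_norm_sq, ← Complex.re_sum, h.sum_inner,
    Complex.sub_re, Complex.re_ofReal_mul, map_sub, inner_sub_left, inner_sub_left,
    ← h.inner_symm, Complex.sub_re, Complex.sub_re, re_inner_self, re_inner_self] at hnn
  linarith

/-- The spectral gap `N ≥ 1` on the range of `Y (1 - α Y)`. -/
theorem gap_of_range (h : IsLoweringSystem α Y X) (hα : 0 < α) (v : H) :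
    (α + 1) * (⟪Y v - (α : ℂ) • Y (Y v), Y (Y v - (α : ℂ) • Y (Y v))⟫_ℂ).re ≤
      ‖Y v - (α : ℂ) • Y (Y v)‖ ^ 2 := by
  have hq := h.quadratic_nonneg v
  set w := Y v
  have hB := h.mul_re_inner_le hα (w - ((α + 1 : ℝ) : ℂ) • (w - (α : ℂ) • Y w))
  have h1 : ⟪w, Y (Y w)⟫_ℂ = ⟪Y w, Y w⟫_ℂ := (h.inner_symm _ _).symm
  have h2 : ⟪w, Y w⟫_ℂ = ⟪Y w, w⟫_ℂ := (h.inner_symm _ _).symm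
  have h3 : (⟪Y (Y w), Y w⟫_ℂ).re = (⟪Y w, Y (Y w)⟫_ℂ).re := re_inner_comm _ _
  rw [← re_inner_self] at hB hq hq ⊢
  simp only [map_sub, map_smul, inner_sub_left, inner_sub_right, inner_smul_left,
    inner_smul_right, Complex.conj_ofReal, Complex.sub_re, Complex.re_ofReal_mul, h1, h2] at hB hq ⊢
  refine le_of_mul_le_mul_left (a := α * (α + 1)) ?_ (by positivity)
  linarith [mul_nonneg hα.le hq]

theorem gap_of_orthogonal [CompleteSpace H] (h : IsLoweringSystem α Y X) (hα : 0 < α) {ψ : H}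
    (hker : ∀ φ, Y φ = 0 → ⟪ψ, φ⟫_ℂ = 0)
    (htop : ∀ φ, Y φ = ((α⁻¹ : ℝ) : ℂ) • φ → ⟪ψ, φ⟫_ℂ = 0) :
    (α + 1) * (⟪ψ, Y ψ⟫_ℂ).re ≤ ‖ψ‖ ^ 2 := by
  let A : H →L[ℂ] H := Y - (α : ℂ) • Y * Y
  have hA : ∀ v, A v = Y v - (α : ℂ) • Y (Y v) := fun v => rfl
  have hAsymm : ∀ u v, ⟪A u, v⟫_ℂ = ⟪u, A v⟫_ℂ := fun u v => by
    simp only [hA, inner_sub_left, inner_sub_right, inner_smul_left, inner_smul_right,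
      Complex.conj_ofReal, h.inner_symm]
  have hmem : ψ ∈ closure (Set.range A) := by
    have : ψ ∈ A.rangeᗮᗮ := by
      rw [Submodule.mem_orthogonal]
      intro z hz
      have hz0 : A z = 0 := by
        rw [← inner_self_eq_zero (𝕜 := ℂ), hAsymm, inner_eq_zero_symm]
        exact Submodule.inner_right_of_mem_orthogonal (𝕜 := ℂ) (LinearMap.mem_range_self _ _) hz
      rw [hA, sub_eq_zero] at hz0
      have hα' : (α : ℂ) ≠ 0 := by exact_mod_cast hα.ne'
      have h1 := hker (z - (α : ℂ) • Y z) (by rw [map_sub, map_smul, ← hz0, sub_self])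
      have h2 := htop (Y z) (by
        conv_rhs => rw [hz0]
        rw [smul_smul, Complex.ofReal_inv, inv_mul_cancel₀ hα', one_smul])
      rw [inner_sub_right, inner_smul_right, h2, mul_zero, sub_zero] at h1
      exact inner_eq_zero_symm.1 h1
    rw [Submodule.orthogonal_orthogonal_eq_closure] at this
    exact this
  have hclosed : IsClosed {u : H | (α + 1) * (⟪u, Y u⟫_ℂ).re ≤ ‖u‖ ^ 2} := by
    refine isClosed_le ?_ (by fun_prop)
    exact continuous_const.mul (Complex.continuous_re.comp (continuous_id.inner Y.continuous))
  refine closure_minimal ?_ hclosed hmem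
  rintro _ ⟨v, rfl⟩
  exact h.gap_of_range hα v

theorem exists_approximate_eigenvectors (h : IsLoweringSystem α Y X) (hα : 0 < α)
    {M : Submodule ℂ H} (hY : ∀ v ∈ M, Y v ∈ M) (hne : ∃ v ∈ M, Y v ≠ 0) :
    ∃ (l : ℝ) (v : ℕ → H), 0 < l ∧ (∀ u ∈ M, ‖Y u‖ ≤ l * ‖u‖) ∧ (∀ n, v n ∈ M) ∧
      (∀ n, ‖v n‖ ≤ 1) ∧ Filter.Tendsto (fun n => ‖Y (v n)‖) Filter.atTop (nhds l) ∧
      Filter.Tendsto (fun n => Y (v n) - (l : ℂ) • v n) Filter.atTop (nhds 0) := by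
  let f : M →L[ℂ] H := Y ∘L M.subtypeL
  have hf : ∀ u ∈ M, ‖Y u‖ ≤ ‖f‖ * ‖u‖ := fun u hu => f.le_opNorm ⟨u, hu⟩
  have hl : 0 < ‖f‖ := by
    obtain ⟨v, hv, hv0⟩ := hne
    by_contra hle
    have h0 : ‖f‖ = 0 := le_antisymm (not_lt.1 hle) (norm_nonneg f)
    have := hf v hv
    rw [h0, zero_mul] at this
    exact hv0 (norm_le_zero_iff.1 this)
  have hex : ∀ n : ℕ, ∃ x : M, ‖x‖ < 1 ∧ ‖f‖ - 1 / ((n : ℝ) + 1) < ‖f x‖ := fun n =>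
    f.exists_lt_apply_of_lt_opNorm (sub_lt_self _ (by positivity))
  choose x hx1 hx2 using hex
  have hx1' : ∀ n, ‖(x n : H)‖ ≤ 1 := fun n => (hx1 n).le
  have hle : ∀ n, ‖Y (x n)‖ ≤ ‖f‖ := fun n =>
    (hf _ (x n).2).trans (mul_le_of_le_one_right hl.le (hx1' n))
  have hlim : Filter.Tendsto (fun n => ‖Y (x n)‖) Filter.atTop (nhds ‖f‖) := by
    refine tendsto_of_tendsto_of_tendsto_of_le_of_le ?_ tendsto_const_nhds
      (fun n => (hx2 n).le) hle
    simpa using tendsto_const_nhds.sub (tendsto_one_div_add_atTop_nhds_zero_nat (𝕜 := ℝ))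
  refine ⟨‖f‖, fun n => (x n : H), hl, hf, fun n => (x n).2, hx1', hlim, ?_⟩
  set l := ‖f‖
  have hbound : ∀ n, ‖Y (x n) - (l : ℂ) • (x n : H)‖ ^ 2 ≤ l ^ 2 - ‖Y (x n)‖ ^ 2 := by
    intro n
    set v : H := (x n : H)
    set r := Y v - (l : ℂ) • v with hr
    have h1 : ‖Y (Y v)‖ ^ 2 ≤ l ^ 2 * ‖Y v‖ ^ 2 := by
      rw [← mul_pow]
      exact pow_le_pow_left₀ (norm_nonneg _) (hf _ (hY _ (x n).2)) 2
    have h2 : ‖v‖ ^ 2 ≤ 1 := pow_le_one₀ (norm_nonneg _) (hx1' n)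
    have h3 : ‖Y r + (l : ℂ) • r‖ ^ 2 ≤ l ^ 2 * (l ^ 2 - ‖Y v‖ ^ 2) := by
      have heq : Y r + (l : ℂ) • r = Y (Y v) - ((l ^ 2 : ℝ) : ℂ) • v := by
        rw [hr, map_sub, map_smul, smul_sub, smul_smul]
        push_cast
        rw [sq]
        abel
      rw [heq, ← re_inner_self]
      simp only [inner_sub_left, inner_sub_right, inner_smul_left, inner_smul_right,
        Complex.conj_ofReal, Complex.sub_re, Complex.re_ofReal_mul]
      rw [h.inner_symm (Y v) v, re_inner_comm v (Y (Y v)), h.inner_symm (Y v) v, re_inner_self,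
        re_inner_self, re_inner_self]
      nlinarith [mul_le_mul_of_nonneg_left h2 (sq_nonneg (l ^ 2))]
    have h4 : l ^ 2 * ‖r‖ ^ 2 ≤ ‖Y r + (l : ℂ) • r‖ ^ 2 := by
      have := h.re_inner_nonneg hα r
      rw [← re_inner_self (Y r + _)]
      simp only [inner_add_left, inner_add_right, inner_smul_left, inner_smul_right,
        Complex.conj_ofReal, Complex.add_re, Complex.re_ofReal_mul]
      rw [re_inner_comm (Y r) r, re_inner_self, re_inner_self]
      nlinarith [sq_nonneg ‖Y r‖, mul_nonneg hl.le this]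
    exact le_of_mul_le_mul_left (h4.trans h3) (by positivity)
  rw [tendsto_zero_iff_norm_tendsto_zero]
  have hsq : Filter.Tendsto (fun n => ‖Y (x n) - (l : ℂ) • (x n : H)‖ ^ 2) Filter.atTop (nhds 0) := by
    refine squeeze_zero (fun n => by positivity) hbound ?_
    rw [← sub_self (l ^ 2)]
    exact tendsto_const_nhds.sub (hlim.pow 2)
  simpa [Real.sqrt_sq (norm_nonneg _)] using hsq.sqrt

/-- On an invariant subspace where `N ≥ 1` and which `X_j` cannot leave, `Y` vanishes: the top of
the spectrum of `Y` would be raised by `X_j`. -/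
theorem eq_zero_of_gap (h : IsLoweringSystem α Y X) (hα : 0 < α) {M : Submodule ℂ H}
    (hY : ∀ v ∈ M, Y v ∈ M) (hX : ∀ j, ∀ v ∈ M, X j v ∈ M)
    (hgap : ∀ v ∈ M, (α + 1) * (⟪v, Y v⟫_ℂ).re ≤ ‖v‖ ^ 2) {v : H} (hv : v ∈ M) : Y v = 0 := by
  by_contra hv0
  obtain ⟨l, v, hl, hM, hvM, hv1, hlim, hr⟩ :=
    h.exists_approximate_eigenvectors hα hY ⟨v, hv, hv0⟩
  have hinner : Filter.Tendsto (fun n => (⟪v n, Y (v n)⟫_ℂ).re) Filter.atTop (nhds l) := by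
    have hexp : ∀ n, (⟪v n, Y (v n)⟫_ℂ).re =
        l⁻¹ * (‖Y (v n)‖ ^ 2 - (⟪Y (v n) - (l : ℂ) • v n, Y (v n)⟫_ℂ).re) := by
      intro n
      rw [inner_sub_left, inner_smul_left, Complex.sub_re, Complex.conj_ofReal,
        Complex.re_ofReal_mul, re_inner_self]
      field_simp
      ring
    have hsmall : Filter.Tendsto (fun n => (⟪Y (v n) - (l : ℂ) • v n, Y (v n)⟫_ℂ).re)
        Filter.atTop (nhds 0) := by
      have hn := (tendsto_zero_iff_norm_tendsto_zero.1 hr).mul hlim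
      rw [zero_mul] at hn
      refine squeeze_zero_norm (fun n => ?_) hn
      exact (Complex.abs_re_le_norm _).trans (norm_inner_le_norm _ _)
    simp_rw [hexp]
    have := ((hlim.pow 2).sub hsmall).const_mul l⁻¹
    convert this using 2
    field_simp
    ring
  have hl1 : (α + 1) * l ≤ 1 :=
    le_of_tendsto (hinner.const_mul (α + 1)) (Filter.Eventually.of_forall fun n =>
      (hgap _ (hvM n)).trans (pow_le_one₀ (norm_nonneg _) (hv1 n)))
  have hl2 : l ≤ 1 := by nlinarith
  have hXlim : ∀ j, Filter.Tendsto (fun n => ‖X j (v n)‖) Filter.atTop (nhds 0) := by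
    intro j
    have hXr : Filter.Tendsto (fun n => (l ^ 2)⁻¹ * ((1 + l) * ‖X j (Y (v n) - (l : ℂ) • v n)‖))
        Filter.atTop (nhds 0) := by
      have := (((X j).continuous.tendsto 0).comp hr).norm.const_mul (1 + l)
        |>.const_mul (l ^ 2)⁻¹
      simpa using this
    refine squeeze_zero (fun n => norm_nonneg _) (fun n => ?_) hXr
    set r := Y (v n) - (l : ℂ) • v n with hrdef
    have hYv : Y (v n) = (l : ℂ) • v n + r := by rw [hrdef]; abel
    have hrel : X j (Y (v n)) = Y (X j (v n - Y (v n))) := by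
      rw [map_sub, map_sub, h.map_apply, add_sub_cancel_right]
    have hle := hM _ (hX j _ (M.sub_mem (hvM n) (hY _ (hvM n))))
    rw [← hrel] at hle
    have e1 : X j (Y (v n)) = (l : ℂ) • X j (v n) + X j r := by rw [hYv, map_add, map_smul]
    have e2 : X j (v n - Y (v n)) = ((1 - l : ℝ) : ℂ) • X j (v n) - X j r := by
      rw [hYv, map_sub, map_add, map_smul]
      push_cast
      rw [sub_smul, one_smul]
      abel
    rw [e1, e2] at hle
    have n1 : l * ‖X j (v n)‖ - ‖X j r‖ ≤ ‖(l : ℂ) • X j (v n) + X j r‖ := by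
      have := norm_sub_le ((l : ℂ) • X j (v n) + X j r) (X j r)
      rw [add_sub_cancel_right, norm_smul, Complex.norm_real, Real.norm_of_nonneg hl.le] at this
      linarith
    have n2 : ‖((1 - l : ℝ) : ℂ) • X j (v n) - X j r‖ ≤ (1 - l) * ‖X j (v n)‖ + ‖X j r‖ := by
      have := norm_sub_le (((1 - l : ℝ) : ℂ) • X j (v n)) (X j r)
      rwa [norm_smul, Complex.norm_real, Real.norm_of_nonneg (sub_nonneg.2 hl2)] at this
    rw [le_inv_mul_iff₀ (by positivity)]
    nlinarith
  have hsum : Filter.Tendsto (fun n => ∑ j, ‖X j (v n)‖ ^ 2) Filter.atTop (nhds 0) := by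
    simpa using tendsto_finsetSum Finset.univ fun j _ => (hXlim j).pow 2
  simp_rw [h.sum_norm_sq] at hsum
  have := tendsto_nhds_unique hsum (hinner.sub ((hlim.pow 2).const_mul α))
  have : l * (1 - α * l) = 0 := by linarith
  rcases mul_eq_zero.1 this with h0 | h0 <;> nlinarith

end IsLoweringSystem

end LoweringSystem

section LevelSpaces

variable {H : Type*} [NormedAddCommGroup H] [InnerProductSpace ℂ H] {Y T : H →L[ℂ] H}

/-- If `T` lowers `N` by `δ`, it maps the eigenvalue `μ⁻¹` of `Y` to `(μ - δ)⁻¹`. -/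
theorem eigen_shift {δ : ℤ}
    (hT : ∀ v, Y (T v) = T (Y v) + (δ : ℂ) • Y (T (Y v))) {μ : ℝ} (hμ : μ ≠ 0)
    (hμδ : μ - δ ≠ 0) {v : H} (hv : Y v = ((μ⁻¹ : ℝ) : ℂ) • v) :
    Y (T v) = (((μ - δ)⁻¹ : ℝ) : ℂ) • T v := by
  have h1 := hT v
  rw [hv, map_smul, map_smul] at h1
  have hμ' : (μ : ℂ) ≠ 0 := by exact_mod_cast hμ
  have hμδ' : (μ : ℂ) - δ ≠ 0 := by exact_mod_cast hμδ
  have h2 : ((μ : ℂ) - δ) • Y (T v) = T v := by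
    have h3 := congrArg (fun w => (μ : ℂ) • w) h1
    simp only [smul_add, smul_smul, Complex.ofReal_inv] at h3
    rw [mul_inv_cancel₀ hμ', one_smul, mul_left_comm, mul_inv_cancel₀ hμ', mul_one] at h3
    rw [sub_smul, h3, add_sub_cancel_right]
  conv_rhs => rw [← h2]
  rw [smul_smul]
  push_cast
  rw [inv_mul_cancel₀ hμδ', one_smul]

namespace IsLoweringSystem

variable {ι : Type*} [Fintype ι] {α : ℝ} {X X' : ι → H →L[ℂ] H}

theorem eq_zero_of_eigen_lt (h : IsLoweringSystem α Y X) {μ : ℝ} (hμ : μ ≠ 0) (hμα : μ < α) {v : H}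
    (hv : Y v = ((μ⁻¹ : ℝ) : ℂ) • v) : v = 0 := by
  have h1 := h.mul_norm_sq_le v
  rw [hv, inner_smul_right, Complex.re_ofReal_mul, re_inner_self, norm_smul, Complex.norm_real,
    mul_pow, Real.norm_eq_abs, sq_abs] at h1
  have h2 : α * ‖v‖ ^ 2 ≤ μ * ‖v‖ ^ 2 := by
    have := mul_le_mul_of_nonneg_left h1 (sq_nonneg μ)
    have e1 : μ ^ 2 * (α * (μ⁻¹ ^ 2 * ‖v‖ ^ 2)) = α * ‖v‖ ^ 2 := by field_simp
    have e2 : μ ^ 2 * (μ⁻¹ * ‖v‖ ^ 2) = μ * ‖v‖ ^ 2 := by field_simp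
    rwa [e1, e2] at this
  have h3 : ‖v‖ ^ 2 ≤ 0 := by nlinarith [sq_nonneg ‖v‖]
  simpa using le_antisymm h3 (sq_nonneg _)

theorem map_adjoint_apply (h : IsLoweringSystem α Y X)
    (hX' : ∀ j u v, ⟪X j u, v⟫_ℂ = ⟪u, X' j v⟫_ℂ) (j : ι) (v : H) :
    Y (X' j v) = X' j (Y v) + ((-1 : ℤ) : ℂ) • Y (X' j (Y v)) := by
  refine ext_inner_left ℂ fun u => ?_
  rw [inner_add_right, inner_smul_right, ← h.inner_symm, ← h.inner_symm, ← hX', ← hX', ← hX',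
    ← h.inner_symm, h.map_apply, inner_add_left, h.inner_symm (X j (Y u)) v]
  push_cast
  ring

theorem sum_adjoint_apply (h : IsLoweringSystem α Y X)
    (hX' : ∀ j u v, ⟪X j u, v⟫_ℂ = ⟪u, X' j v⟫_ℂ) (v : H) :
    ∑ j, X' j (X j v) = Y v - (α : ℂ) • Y (Y v) := by
  refine ext_inner_left ℂ fun u => ?_
  rw [inner_sum, inner_sub_right, inner_smul_right, ← h.inner_symm u (Y v), ← h.sum_inner]
  simp_rw [hX']

/-- Every eigenspace of `Y` at `(α + s)⁻¹` is reached from the lowest one by the adjoints `X_j*`. -/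
theorem mem_of_eigen (h : IsLoweringSystem α Y X) (hα : 0 < α)
    (hX' : ∀ j u v, ⟪X j u, v⟫_ℂ = ⟪u, X' j v⟫_ℂ) {V : Submodule ℂ H}
    (h0 : ∀ v, Y v = ((α⁻¹ : ℝ) : ℂ) • v → v ∈ V) (hV : ∀ j, ∀ v ∈ V, X' j v ∈ V) (s : ℕ) :
    ∀ v, Y v = (((α + s)⁻¹ : ℝ) : ℂ) • v → v ∈ V := by
  induction s with
  | zero => simpa using h0
  | succ s ih =>
    intro v hv
    have hmem : ∑ j, X' j (X j v) ∈ V := by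
      refine V.sum_mem fun j _ => hV j _ (ih _ ?_)
      have := eigen_shift (δ := 1) (T := X j) (fun v => by
        rw [Int.cast_one, one_smul, h.map_apply]) (by positivity)
        (by push_cast; ring_nf; positivity) hv
      convert this using 4
      push_cast
      ring
    rw [h.sum_adjoint_apply hX', hv, map_smul, hv, smul_smul, smul_smul, ← sub_smul] at hmem
    refine (V.smul_mem_iff ?_).1 hmem
    norm_cast
    have hpos : (0 : ℝ) < α + (s + 1 : ℕ) := by positivity
    have : (α + (s + 1 : ℕ))⁻¹ - α * ((α + (s + 1 : ℕ))⁻¹ * (α + (s + 1 : ℕ))⁻¹) =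
        (s + 1 : ℕ) / (α + (s + 1 : ℕ)) ^ 2 := by
      field_simp
      ring
    rw [← mul_assoc] at this
    rw [this]
    refine ne_of_gt ?_
    positivity

end IsLoweringSystem

end LevelSpaces

section Representations

variable {d : ℕ} {α : ℝ} {xop : ℤ → ℤ → BdOp d} {yop : ℤ → BdOp d}
  {H : Type*} [NormedAddCommGroup H] [InnerProductSpace ℂ H]
  (π : ↥(Xalg d xop yop) →ₐ[ℂ] (H →L[ℂ] H))

theorem xop_mem_Xalg {k l : ℤ} (hk : |k| ≤ (d : ℤ)) (hl : |l| ≤ (d : ℤ)) :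
    xop k l ∈ Xalg d xop yop :=
  Algebra.subset_adjoin (Or.inl ⟨k, l, hk, hl, rfl⟩)

theorem xop_pos_zero_mem_Xalg (j : Fin d) : xop ((j : ℕ) + 1 : ℤ) 0 ∈ Xalg d xop yop :=
  xop_mem_Xalg (abs_le.2 (by omega)) (by simp)

theorem map_homogeneous {Ty T : ↥(Xalg d xop yop)} {δ : ℤ}
    (hT : (Ty * T : BdOp d) = T * Ty + (δ : ℂ) • (Ty * T * Ty : BdOp d)) (v : H) :
    π Ty (π T v) = π T (π Ty v) + (δ : ℂ) • π Ty (π T (π Ty v)) := by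
  have : Ty * T = T * Ty + (δ : ℂ) • (Ty * T * Ty) := Subtype.ext hT
  have := congrArg (fun S => π S v) this
  simpa only [map_mul, map_add, map_smul, mul_apply_eq_comp, add_apply, smul_apply] using this

/-- A subspace invariant under all homogeneous elements is invariant under `X`. -/
theorem IsXYSystem.invariant_of_homogeneous (hxy : IsXYSystem d α xop yop) (hα : 0 < α)
    {Ty : ↥(Xalg d xop yop)} (hTy : (Ty : BdOp d) = yop 0) {S : Submodule ℂ H}
    (hS : ∀ (T : ↥(Xalg d xop yop)) (δ : ℤ),
      (∀ v, π Ty (π T v) = π T (π Ty v) + (δ : ℂ) • π Ty (π T (π Ty v))) →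
      ∀ φ ∈ S, π T φ ∈ S)
    (T : ↥(Xalg d xop yop)) : ∀ φ ∈ S, π T φ ∈ S := by
  obtain ⟨T, hT⟩ := T
  induction hT using Algebra.adjoin_induction with
  | mem T hT =>
    obtain ⟨k, l, hk, hl, rfl⟩ | ⟨m, rfl⟩ := hT
    · refine hS _ (k.sign + l.sign) (map_homogeneous π ?_)
      rw [hTy]
      exact hxy.yop_mul_xop hα hk hl
    · refine hS _ 0 (map_homogeneous π ?_)
      rw [hTy]
      simpa using hxy.commute_yop m
  | algebraMap r =>
    intro φ hφ
    have : π ⟨algebraMap ℂ (BdOp d) r, algebraMap_mem _ r⟩ = algebraMap ℂ (H →L[ℂ] H) r :=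
      π.commutes r
    rw [this]
    exact S.smul_mem r hφ
  | add T U hT hU ihT ihU =>
    intro φ hφ
    have : π ⟨T + U, add_mem hT hU⟩ = π ⟨T, hT⟩ + π ⟨U, hU⟩ := map_add π ⟨T, hT⟩ ⟨U, hU⟩
    rw [this]
    exact S.add_mem (ihT φ hφ) (ihU φ hφ)
  | mul T U hT hU ihT ihU =>
    intro φ hφ
    have : π ⟨T * U, mul_mem hT hU⟩ = π ⟨T, hT⟩ * π ⟨U, hU⟩ := map_mul π ⟨T, hT⟩ ⟨U, hU⟩
    rw [this]
    exact ihT _ (ihU φ hφ)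

variable {π} [CompleteSpace H]

theorem IsStarRep.inner_apply (hπ : IsStarRep d xop yop π) {T U : ↥(Xalg d xop yop)}
    (h : (T : BdOp d) = star (U : BdOp d)) (u v : H) : ⟪π U u, v⟫_ℂ = ⟪u, π T v⟫_ℂ := by
  rw [hπ T U h, ContinuousLinearMap.star_eq_adjoint, ContinuousLinearMap.adjoint_inner_right]

theorem IsStarRep.isLoweringSystem (hπ : IsStarRep d xop yop π) (hxy : IsXYSystem d α xop yop)
    (hα : 0 < α) {Ty : ↥(Xalg d xop yop)} (hTy : (Ty : BdOp d) = yop 0)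
    {X' : Fin d → ↥(Xalg d xop yop)}
    (hX' : ∀ j : Fin d, (X' j : BdOp d) = star (xop ((j : ℕ) + 1 : ℤ) 0)) :
    IsLoweringSystem α (π Ty)
      (fun j : Fin d => π ⟨xop ((j : ℕ) + 1 : ℤ) 0, xop_pos_zero_mem_Xalg j⟩) where
  inner_symm u v := hπ.inner_apply (T := Ty) (U := Ty) (by rw [hTy, hxy.star_yop]) u v
  sum_inner u v := by
    have hsum : ∑ j : Fin d, X' j * ⟨xop ((j : ℕ) + 1 : ℤ) 0, xop_pos_zero_mem_Xalg j⟩ =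
        Ty - (α : ℂ) • (Ty * Ty) := by
      refine Subtype.ext ?_
      change (Xalg d xop yop).val (∑ j : Fin d,
          X' j * ⟨xop ((j : ℕ) + 1 : ℤ) 0, xop_pos_zero_mem_Xalg j⟩) =
        (Xalg d xop yop).val (Ty - (α : ℂ) • (Ty * Ty))
      simp only [map_sum, map_mul, map_sub, map_smul, Subalgebra.coe_val, hX', hTy]
      exact hxy.sum_star_xop_mul_xop hα
    have := congrArg (fun S => ⟪u, π S v⟫_ℂ) hsum
    simp only [map_sum, map_mul, map_sub, map_smul, sum_apply, mul_apply_eq_comp,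
      sub_apply, smul_apply, inner_sum, inner_sub_right, inner_smul_right] at this
    have hy := hπ.inner_apply (T := Ty) (U := Ty) (by rw [hTy, hxy.star_yop]) u (π Ty v)
    rw [hy, ← this]
    exact Finset.sum_congr rfl fun j _ => hπ.inner_apply
      (U := ⟨xop ((j : ℕ) + 1 : ℤ) 0, xop_pos_zero_mem_Xalg j⟩) (hX' j) _ _
  map_apply j v := by
    have := map_homogeneous π (Ty := Ty) (δ := 1)
      (T := ⟨xop ((j : ℕ) + 1 : ℤ) 0, xop_pos_zero_mem_Xalg j⟩) (by
        have := hxy.yop_mul_xop hα (k := (j : ℕ) + 1) (l := 0) (abs_le.2 (by omega)) (by simp)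
        rw [Int.sign_zero, add_zero, Int.sign_eq_one_of_pos (by omega)] at this
        rwa [hTy]) v
    rwa [Int.cast_one, one_smul] at this

/-- The closed span of the `π((x^𝔫)*) K₀` is spanned by the eigenspaces of `π(y₀)` at the
`(α + s)⁻¹`, `s ∈ ℕ`. -/
theorem IsStarRep.span_eq (hπ : IsStarRep d xop yop π) (hxy : IsXYSystem d α xop yop)
    (hα : 0 < α) {Ty : ↥(Xalg d xop yop)} (hTy : (Ty : BdOp d) = yop 0)
    {xs : (Fin d → ℕ) → ↥(Xalg d xop yop)}
    (hxs : ∀ n : Fin d → ℕ, (xs n : BdOp d) = star (xPowZ d xop n)) :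
    Submodule.span ℂ (⋃ n : Fin d → ℕ, π (xs n) '' {φ : H | π Ty φ = ((α⁻¹ : ℝ) : ℂ) • φ}) =
      Submodule.span ℂ {φ : H | ∃ s : ℕ, π Ty φ = (((α + s)⁻¹ : ℝ) : ℂ) • φ} := by
  have hX' : ∀ j : Fin d,
      (xs (Pi.single j 1) : BdOp d) = star (xop ((j : ℕ) + 1 : ℤ) 0) := fun j => by
    rw [hxs, ← zero_add (Pi.single j 1), hxy.xPowZ_add_single, xPowZ_zero, one_mul]
  have hsys := hπ.isLoweringSystem hxy hα hTy hX'
  have hadj := fun (j : Fin d) (u v : H) => hπ.inner_apply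
    (U := ⟨xop ((j : ℕ) + 1 : ℤ) 0, xop_pos_zero_mem_Xalg j⟩) (hX' j) u v
  have hsucc : ∀ n j, π (xs (n + Pi.single j 1)) = π (xs (Pi.single j 1)) * π (xs n) := by
    intro n j
    rw [← map_mul]
    congr 1
    refine Subtype.ext ?_
    rw [Subalgebra.coe_mul, hxs, hX', hxs, hxy.xPowZ_add_single, star_mul]
  have hzero : π (xs 0) = 1 := by
    rw [← map_one π]
    congr 1
    refine Subtype.ext ?_
    rw [hxs, xPowZ_zero, star_one]
    rfl
  refine le_antisymm (Submodule.span_le.2 ?_) (Submodule.span_le.2 ?_)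
  · refine Set.iUnion_subset fun n => ?_
    rintro _ ⟨φ, hφ, rfl⟩
    refine Submodule.subset_span ⟨degIdx d n, ?_⟩
    obtain ⟨s, hs⟩ : ∃ s, degIdx d n = s := ⟨_, rfl⟩
    rw [hs]
    induction s generalizing n with
    | zero =>
      have hn : n = 0 := by
        funext k
        exact Finset.sum_eq_zero_iff.1 hs k (Finset.mem_univ k)
      simpa [hn, hzero] using hφ
    | succ s ih =>
      obtain ⟨k, hk⟩ : ∃ k, n k ≠ 0 := by
        by_contra! hcon
        simp [degIdx, hcon] at hs
      obtain ⟨m, rfl⟩ : ∃ m : Fin d → ℕ, n = m + Pi.single k 1 := by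
        refine ⟨n - Pi.single k 1, (tsub_add_cancel_of_le ?_).symm⟩
        intro i
        rcases eq_or_ne i k with rfl | h
        · simpa using Nat.one_le_iff_ne_zero.2 hk
        · simp [h]
      have hm : degIdx d m = s := by
        simpa [degIdx, Finset.sum_add_distrib] using hs
      rw [hsucc, mul_apply_eq_comp]
      have := eigen_shift (hsys.map_adjoint_apply hadj k) (by positivity)
        (by push_cast; ring_nf; positivity) (ih m hm)
      convert this using 4
      push_cast
      ring
  · rintro φ ⟨s, hs⟩
    refine hsys.mem_of_eigen hα hadj (fun v hv => ?_) (fun j v hv => ?_) s φ hs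
    · refine Submodule.subset_span (Set.mem_iUnion.2 ⟨0, v, hv, ?_⟩)
      simp [hzero]
    · induction hv using Submodule.span_induction with
      | mem v hv =>
        obtain ⟨n, φ, hφ, rfl⟩ := Set.mem_iUnion.1 hv
        refine Submodule.subset_span (Set.mem_iUnion.2 ⟨n + Pi.single j 1, φ, hφ, ?_⟩)
        rw [hsucc, mul_apply_eq_comp]
      | zero => simp
      | add u v _ _ hu hv =>
        rw [map_add]
        exact Submodule.add_mem _ hu hv
      | smul c v _ hv =>
        rw [map_smul]
        exact Submodule.smul_mem _ c hv

end Representations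

/-- Section 4.1: for any ∗-representation `π` of `X`, with
`H_∞ = ker π(y₀)`, `K₀ = ker(π(y₀) − α⁻¹ I)` and `H₁` the closed linear span
of `⋃_𝔫 π((x^𝔫)*) K₀`, the subspaces `H₁` and `H_∞` are invariant, mutually
orthogonal, and `H = H₁ ⊕ H_∞`. -/
theorem stmt13 (d : ℕ) (hd : 1 ≤ d) (α : ℝ) (hα : 0 < α)
    (hαint : ∀ z : ℤ, α ≠ (z : ℝ))
    (xop : ℤ → ℤ → BdOp d) (yop : ℤ → BdOp d) (hxy : IsXYSystem d α xop yop)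
    {H : Type*} [NormedAddCommGroup H] [InnerProductSpace ℂ H] [CompleteSpace H]
    (π : ↥(Xalg d xop yop) →ₐ[ℂ] (H →L[ℂ] H)) (hπ : IsStarRep d xop yop π)
    (Ty : ↥(Xalg d xop yop)) (hTy : (Ty : BdOp d) = yop 0)
    (xs : (Fin d → ℕ) → ↥(Xalg d xop yop))
    (hxs : ∀ n : Fin d → ℕ, (xs n : BdOp d) = star (xPowZ d xop n)) :
    -- `K₀`, `H_∞`, `H₁`
    (fun K0 Hinf H1 =>
      (∀ T : ↥(Xalg d xop yop), ∀ φ ∈ H1, π T φ ∈ H1) ∧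
      (∀ T : ↥(Xalg d xop yop), ∀ φ ∈ Hinf, π T φ ∈ Hinf) ∧
      (∀ φ ∈ H1, ∀ ψ ∈ Hinf, ⟪φ, ψ⟫_ℂ = 0) ∧
      (∀ ψ : H, (∀ φ ∈ H1, ⟪ψ, φ⟫_ℂ = 0) → (∀ φ ∈ Hinf, ⟪ψ, φ⟫_ℂ = 0) → ψ = 0))
      {φ : H | π Ty φ = ((α⁻¹ : ℝ) : ℂ) • φ}
      {φ : H | π Ty φ = 0}
      (closure (Submodule.span ℂ
        (⋃ n : Fin d → ℕ,
          π (xs n) '' {φ : H | π Ty φ = ((α⁻¹ : ℝ) : ℂ) • φ}) : Set H)) := by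
  have hX' : ∀ j : Fin d,
      (xs (Pi.single j 1) : BdOp d) = star (xop ((j : ℕ) + 1 : ℤ) 0) := fun j => by
    rw [hxs, ← zero_add (Pi.single j 1), hxy.xPowZ_add_single, xPowZ_zero, one_mul]
  have hsys := hπ.isLoweringSystem hxy hα hTy hX'
  have hadj := fun (j : Fin d) (u v : H) => hπ.inner_apply
    (U := ⟨xop ((j : ℕ) + 1 : ℤ) 0, xop_pos_zero_mem_Xalg j⟩) (hX' j) u v
  simp only [hπ.span_eq hxy hα hTy hxs]
  set V := Submodule.span ℂ {φ : H | ∃ s : ℕ, π Ty φ = (((α + s)⁻¹ : ℝ) : ℂ) • φ}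
  have hVinv : ∀ T : ↥(Xalg d xop yop), ∀ φ ∈ V, π T φ ∈ V := by
    refine hxy.invariant_of_homogeneous π hα hTy fun T δ hT φ hφ => ?_
    induction hφ using Submodule.span_induction with
    | mem v hv =>
      obtain ⟨s, hs⟩ := hv
      have hne : α + s - δ ≠ 0 := fun h0 => hαint (δ - s) (by push_cast; linarith)
      have hshift := eigen_shift hT (by positivity) hne hs
      rcases le_or_gt δ s with hδ | hδ
      · refine Submodule.subset_span ⟨(s - δ).toNat, ?_⟩
        have hcast : (((s - δ).toNat : ℕ) : ℝ) = s - δ := by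
          rw [← Int.cast_natCast, Int.toNat_of_nonneg (sub_nonneg.2 hδ)]
          push_cast
          ring
        rw [hshift, hcast, add_sub_assoc]
      · have hδ' : (s : ℝ) < δ := by exact_mod_cast hδ
        rw [hsys.eq_zero_of_eigen_lt hne (by linarith) hshift]
        exact V.zero_mem
    | zero => simp
    | add u v _ _ hu hv =>
      rw [map_add]
      exact V.add_mem hu hv
    | smul c v _ hv =>
      rw [map_smul]
      exact V.smul_mem c hv
  have hH1inv : ∀ T : ↥(Xalg d xop yop), ∀ φ ∈ closure (V : Set H), π T φ ∈ closure (V : Set H) :=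
    fun T φ hφ => map_mem_closure (π T).continuous hφ (hVinv T)
  have hker : ∀ T : ↥(Xalg d xop yop), ∀ φ : H, π Ty φ = 0 → π Ty (π T φ) = 0 := by
    refine hxy.invariant_of_homogeneous π hα hTy (S := LinearMap.ker (π Ty : H →ₗ[ℂ] H))
      fun T δ hT φ hφ => ?_
    have hφ' : π Ty φ = 0 := hφ
    change π Ty (π T φ) = 0
    rw [hT, hφ']
    simp
  refine ⟨hH1inv, hker, fun φ hφ ψ hψ => ?_, fun ψ h1 hinf => ?_⟩
  · have hVψ : (V : Set H) ⊆ {φ : H | ⟪φ, ψ⟫_ℂ = 0} := by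
      intro φ hφ
      change ⟪φ, ψ⟫_ℂ = 0
      induction hφ using Submodule.span_induction with
      | mem v hv =>
        obtain ⟨s, hs⟩ := hv
        have hψ0 : π Ty ψ = 0 := hψ
        have h0 := hsys.inner_symm v ψ
        rw [hs, hψ0, inner_zero_right, inner_smul_left, Complex.conj_ofReal] at h0
        refine (mul_eq_zero.1 h0).resolve_left ?_
        have : (α + s)⁻¹ ≠ 0 := by positivity
        exact_mod_cast this
      | zero => simp
      | add u v _ _ hu hv => rw [inner_add_left, hu, hv, add_zero]
      | smul c v _ hv => rw [inner_smul_left, hv, mul_zero]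
    exact closure_minimal hVψ
      (isClosed_eq (continuous_id.inner continuous_const) continuous_const) hφ
  · let M : Submodule ℂ H := (V ⊔ LinearMap.ker (π Ty : H →ₗ[ℂ] H))ᗮ
    have hMmem : ∀ v : H, v ∈ M ↔
        (∀ φ ∈ V, ⟪v, φ⟫_ℂ = 0) ∧ ∀ φ : H, π Ty φ = 0 → ⟪v, φ⟫_ℂ = 0 := by
      intro v
      change v ∈ (V ⊔ LinearMap.ker (π Ty : H →ₗ[ℂ] H))ᗮ ↔ _
      rw [← Submodule.inf_orthogonal, Submodule.mem_inf, Submodule.mem_orthogonal',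
        Submodule.mem_orthogonal']
      rfl
    have hMinv : ∀ T U : ↥(Xalg d xop yop), (T : BdOp d) = star (U : BdOp d) →
        ∀ v ∈ M, π U v ∈ M := by
      intro T U hTU v hv
      rw [hMmem] at hv ⊢
      refine ⟨fun φ hφ => ?_, fun φ hφ => ?_⟩
      · rw [hπ.inner_apply hTU]
        exact hv.1 _ (hVinv T φ hφ)
      · rw [hπ.inner_apply hTU]
        exact hv.2 _ (hker T φ hφ)
    have hψM : ψ ∈ M := (hMmem ψ).2 ⟨fun φ hφ => h1 φ (subset_closure hφ), hinf⟩
    have hgap : ∀ v ∈ M, (α + 1) * (⟪v, π Ty v⟫_ℂ).re ≤ ‖v‖ ^ 2 := by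
      intro v hv
      rw [hMmem] at hv
      refine hsys.gap_of_orthogonal hα hv.2 fun φ hφ => hv.1 φ (Submodule.subset_span ⟨0, ?_⟩)
      simpa using hφ
    have hψ0 := hsys.eq_zero_of_gap hα (hMinv Ty Ty (by rw [hTy, hxy.star_yop]))
      (fun j => hMinv _ _ (hX' j)) hgap hψM
    exact inner_self_eq_zero.1 (hinf ψ hψ0)
end
end

section
/- For every k ∈ {1,…,d} and every multi-index 𝔫 ∈ ℕ^d with 𝔫 ≠ 0 and n_k = 0, the following identity of bounded operators on ℓ²(ℕ^d) holds: x_k (x^𝔫)* = (x^𝔫)* ((I − y₂)(I − y₃)⋯(I − y_{|𝔫|+1}))² x_k. -/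
noncomputable section

/-- `xop k` is the continuous extension of `a_k (N+α)⁻¹`:
`e_𝔫 ↦ (√(n_k)/(|𝔫|+α)) e_{𝔫−1_k}` (zero when `n_k = 0`). -/
def IsXk (d : ℕ) (α : ℝ) (xop : Fin d → BdOp d) : Prop :=
  ∀ (k : Fin d) (n : Fin d → ℕ),
    xop k (e2 d n) =
      ((Real.sqrt (n k) / ((degIdx d n : ℝ) + α) : ℝ) : ℂ) •
        e2 d (Function.update n k (n k - 1))

/-- `yop m` is the diagonal operator `y_m = (N+α+m)⁻¹`:
`e_𝔫 ↦ (|𝔫|+α+m)⁻¹ e_𝔫`. -/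
def IsYm (d : ℕ) (α : ℝ) (yop : ℤ → BdOp d) : Prop :=
  ∀ (m : ℤ) (n : Fin d → ℕ),
    yop m (e2 d n) = ((((degIdx d n : ℝ) + α + m)⁻¹ : ℝ) : ℂ) • e2 d n

/-- The operator `x^𝔫 = x₁^{n₁} ⋯ x_d^{n_d}`. -/
def xPow (d : ℕ) (xop : Fin d → BdOp d) (n : Fin d → ℕ) : BdOp d :=
  (List.ofFn fun j : Fin d => xop j ^ n j).prod

/-- The relations `x T = T (A₂ ⋯ A_{s+1})² x` and `A_i T = T A_{i+s}`, for the adjoint `T` of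
a monomial of degree `s`. -/
def ShiftRel {M : Type*} [Monoid M] (A : ℤ → M) (x T : M) (s : ℕ) : Prop :=
  (∀ i, A i * T = T * A (i + s)) ∧
    x * T = T * ((List.ofFn fun j : Fin s => A ((j : ℕ) + 2)).prod) ^ 2 * x

theorem ShiftRel.one {M : Type*} [Monoid M] (A : ℤ → M) (x : M) : ShiftRel A x 1 0 := by
  simp [ShiftRel]

theorem list_ofFn_prod_mul_of_shift {M : Type*} [Monoid M] {A : ℤ → M} {T : M} {t : ℕ}
    (h : ∀ i, A i * T = T * A (i + t)) (s : ℕ) (c : ℤ) :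
    (List.ofFn fun j : Fin s => A ((j : ℕ) + c)).prod * T =
      T * (List.ofFn fun j : Fin s => A ((j : ℕ) + c + t)).prod := by
  induction s with
  | zero => simp
  | succ s ih =>
    simp only [List.ofFn_succ', List.concat_eq_append, List.prod_append, List.prod_singleton,
      Fin.val_castSucc, Fin.val_last]
    rw [mul_assoc, h, ← mul_assoc, ih, mul_assoc]

theorem ShiftRel.mul {M : Type*} [Monoid M] {A : ℤ → M} (hA : ∀ i j, Commute (A i) (A j))
    {x T U : M} {s t : ℕ} (hT : ShiftRel A x T s) (hU : ShiftRel A x U t) :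
    ShiftRel A x (T * U) (t + s) := by
  refine ⟨fun i => ?_, ?_⟩
  · rw [← mul_assoc, hT.1, mul_assoc, hU.1, mul_assoc]
    push_cast
    rw [add_right_comm, add_assoc]
  · have hsplit : (List.ofFn fun j : Fin (t + s) => A ((j : ℕ) + 2)).prod =
        (List.ofFn fun j : Fin t => A ((j : ℕ) + 2)).prod *
          (List.ofFn fun j : Fin s => A ((j : ℕ) + 2 + t)).prod := by
      rw [List.ofFn_add, List.prod_append]
      congr 4
      funext j
      congr 1
      simp only [Fin.val_natAdd]
      push_cast
      ring
    have hcomm : Commute (List.ofFn fun j : Fin t => A ((j : ℕ) + 2)).prod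
        (List.ofFn fun j : Fin s => A ((j : ℕ) + 2 + t)).prod := by
      refine Commute.list_prod_right _ _ fun a ha => Commute.list_prod_left _ _ fun b hb => ?_
      rw [List.mem_ofFn] at ha hb
      obtain ⟨i, rfl⟩ := ha
      obtain ⟨j, rfl⟩ := hb
      exact hA _ _
    have hshift := list_ofFn_prod_mul_of_shift hU.1 s 2
    rw [hsplit, hcomm.mul_pow, (hcomm.pow_pow 2 2).eq, ← mul_assoc, hT.2, mul_assoc _ x,
      hU.2, pow_two (List.ofFn fun j : Fin s => A ((j : ℕ) + 2)).prod]
    simp only [mul_assoc, pow_two]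
    rw [← mul_assoc _ U, hshift]
    simp only [mul_assoc]
    rw [← mul_assoc _ U, hshift]
    simp only [mul_assoc]

theorem ShiftRel.star_pow {M : Type*} [Monoid M] [StarMul M] {A : ℤ → M}
    (hA : ∀ i j, Commute (A i) (A j)) {x T : M} (hT : ShiftRel A x (star T) 1) (n : ℕ) :
    ShiftRel A x (star (T ^ n)) n := by
  induction n with
  | zero => simpa using ShiftRel.one A x
  | succ n ih =>
    rw [pow_succ, star_mul]
    exact hT.mul hA ih

theorem ShiftRel.star_list_ofFn_prod {M : Type*} [Monoid M] [StarMul M] {A : ℤ → M}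
    (hA : ∀ i j, Commute (A i) (A j)) {x : M} {m : ℕ} (T : Fin m → M) (s : Fin m → ℕ)
    (h : ∀ j, ShiftRel A x (star (T j)) (s j)) :
    ShiftRel A x (star (List.ofFn T).prod) (∑ j, s j) := by
  induction m with
  | zero => simpa using ShiftRel.one A x
  | succ m ih =>
    rw [List.ofFn_succ, List.prod_cons, star_mul, Fin.sum_univ_succ]
    exact (ih _ _ fun j => h j.succ).mul hA (h 0)

theorem BdOp.ext_e2 {d : ℕ} {S T : BdOp d} (h : ∀ n, S (e2 d n) = T (e2 d n)) : S = T := by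
  refine lp.ext_continuousLinearMap (by norm_num) fun n => ?_
  refine ContinuousLinearMap.ext_ring ?_
  simpa [e2] using h n

theorem degIdx_update_succ {d : ℕ} (m : Fin d → ℕ) (j : Fin d) :
    degIdx d (Function.update m j (m j + 1)) = degIdx d m + 1 := by
  have h := Finset.add_sum_erase Finset.univ m (Finset.mem_univ j)
  rw [degIdx, degIdx, Finset.sum_update_of_mem (Finset.mem_univ j), ← h,
    Finset.sdiff_singleton_eq_erase]
  ring

theorem inner_e2 {d : ℕ} (p m : Fin d → ℕ) :
    inner ℂ (e2 d p) (e2 d m) = if p = m then (1 : ℂ) else 0 := by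
  rw [e2, lp.inner_single_left, e2, lp.single_apply]
  simp [Pi.single_apply]

theorem IsXk.star_apply {d : ℕ} {α : ℝ} {xop : Fin d → BdOp d} (hx : IsXk d α xop)
    (j : Fin d) (m : Fin d → ℕ) :
    star (xop j) (e2 d m) =
      ((Real.sqrt (m j + 1) / ((degIdx d m : ℝ) + 1 + α) : ℝ) : ℂ) •
        e2 d (Function.update m j (m j + 1)) := by
  apply lp.ext
  funext p
  have key : ∀ v : L2 d, v p = inner ℂ (e2 d p) v := fun v => by
    rw [e2, lp.inner_single_left]
    simp
  rw [key, key, ContinuousLinearMap.star_eq_adjoint, ContinuousLinearMap.adjoint_inner_right,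
    hx, inner_smul_left, inner_smul_right, inner_e2, inner_e2, Complex.conj_ofReal]
  by_cases hp : p = Function.update m j (m j + 1)
  · subst hp
    simp [degIdx_update_succ]
  · rw [if_neg hp]
    by_cases h0 : p j = 0
    · simp [h0]
    · rw [if_neg, mul_zero, mul_zero]
      rintro rfl
      apply hp
      have : p j - 1 + 1 = p j := by omega
      simp [this]

theorem IsYm.one_sub_apply {d : ℕ} {α : ℝ} {yop : ℤ → BdOp d} (hy : IsYm d α yop)
    (i : ℤ) (m : Fin d → ℕ) :
    (1 - yop i) (e2 d m) = ((1 - ((degIdx d m : ℝ) + α + i)⁻¹ : ℝ) : ℂ) • e2 d m := by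
  rw [sub_apply, hy, one_apply_eq_self]
  push_cast
  rw [sub_smul, one_smul]

theorem IsYm.commute_one_sub {d : ℕ} {α : ℝ} {yop : ℤ → BdOp d} (hy : IsYm d α yop)
    (i j : ℤ) : Commute (1 - yop i) (1 - yop j) := by
  refine BdOp.ext_e2 fun m => ?_
  simp only [mul_apply_eq_comp, hy.one_sub_apply, map_smul]
  rw [smul_comm]

theorem shiftRel_star {d : ℕ} {α : ℝ} (hα : 0 < α) {xop : Fin d → BdOp d}
    (hx : IsXk d α xop) {yop : ℤ → BdOp d} (hy : IsYm d α yop) {k j : Fin d} (hjk : j ≠ k) :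
    ShiftRel (fun i => 1 - yop i) (xop k) (star (xop j)) 1 := by
  refine ⟨fun i => BdOp.ext_e2 fun m => ?_, BdOp.ext_e2 fun m => ?_⟩
  · simp only [mul_apply_eq_comp, hy.one_sub_apply, map_smul, hx.star_apply,
      degIdx_update_succ]
    rw [smul_comm]
    push_cast
    ring_nf
  · simp only [List.ofFn_succ, List.ofFn_zero, List.prod_cons, List.prod_nil, mul_one, pow_two,
      mul_apply_eq_comp, hy.one_sub_apply, map_smul, hx.star_apply, hx k,
      degIdx_update_succ, Function.update_of_ne hjk, Function.update_of_ne hjk.symm]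
    by_cases h0 : m k = 0
    · simp [h0]
    · obtain ⟨q, hq⟩ : ∃ q : Fin d → ℕ, m = Function.update q k (q k + 1) := by
        refine ⟨Function.update m k (m k - 1), ?_⟩
        have : m k - 1 + 1 = m k := by omega
        simp [this]
      subst hq
      have hpos : (0 : ℝ) < degIdx d q + 1 + α := by positivity
      have hpos' : (0 : ℝ) < degIdx d q + 1 + 1 + α := by positivity
      simp only [degIdx_update_succ, Function.update_self, Function.update_idem,
        Function.update_of_ne hjk, Nat.add_sub_cancel, Function.update_eq_self, smul_smul,
        Function.update_comm hjk, ← Complex.ofReal_mul]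
      congr 2
      push_cast
      simp only [Fin.val_zero]
      have e : ((degIdx d q : ℝ) + α + (0 + 2)) = degIdx d q + 1 + 1 + α := by ring
      simp only [Nat.cast_zero, e]
      field_simp
      ring

/-- Lemma 4.1(i): for `𝔫 ≠ 0` with `n_k = 0`,
`x_k (x^𝔫)* = (x^𝔫)* ((I−y₂)⋯(I−y_{|𝔫|+1}))² x_k` as bounded operators. -/
theorem stmt14 (d : ℕ) (hd : 1 ≤ d) (α : ℝ) (hα : 0 < α)
    (hαint : ∀ z : ℤ, α ≠ (z : ℝ))
    (xop : Fin d → BdOp d) (hx : IsXk d α xop)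
    (yop : ℤ → BdOp d) (hy : IsYm d α yop)
    (k : Fin d) (n : Fin d → ℕ) (hn : n ≠ 0) (hnk : n k = 0) :
    xop k * star (xPow d xop n) =
      star (xPow d xop n) *
        ((List.ofFn fun j : Fin (degIdx d n) =>
          (1 : BdOp d) - yop ((j : ℕ) + 2)).prod) ^ 2 * xop k := by
  have hA := hy.commute_one_sub
  refine (ShiftRel.star_list_ofFn_prod hA (fun j => xop j ^ n j) n fun j => ?_).2
  by_cases hjk : j = k
  · subst hjk
    simpa [hnk] using ShiftRel.one _ (xop j)
  · exact (shiftRel_star hα hx hy hjk).star_pow hA (n j)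
end
end
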